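/- Fix m ∈ ℤ and q ∈ K. Let V be the K-vector space with basis {e_i : i ∈ ℤ} ∪ {f_i : i ∈ ℤ}, and let [·,·] be the bilinear bracket on V determined by [e_i,e_j] = δ_{j,m+1}(1−i)e_i + δ_{i,1}(2m+1−j)e_{j−m} − δ_{i,m+1}(1−j)e_j − δ_{j,1}(2m+1−i)e_{i−m}, [e_i,f_j] = δ_{j,m}(1−i)q·e_i + δ_{i,1}( mq·e_{j−m+1} − (j−m)f_{j−m} ) + δ_{i,m+1}·j·f_j, [f_j,e_i] = −[e_i,f_j], and [f_i,f_j] = δ_{i,m}·jq·f_j − δ_{j,m}·iq·f_i for all i, j ∈ ℤ. Then this bracket is alternating and satisfies the Jacobi identity, so it makes V an infinite-dimensional Lie algebra over K. -/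

import Mathlib

noncomputable section

variable (K : Type*) [Field K]

/-- The `K`-vector space with basis `{eᵢ : i ∈ ℤ} ∪ {fᵢ : i ∈ ℤ}`. -/
abbrev VV := (ℤ ⊕ ℤ) →₀ K

/-- The basis vector `eᵢ`. -/
def ee (i : ℤ) : VV K := Finsupp.single (Sum.inl i) 1

/-- The basis vector `fᵢ`. -/
def ff (i : ℤ) : VV K := Finsupp.single (Sum.inr i) 1

/-- The bilinear bracket on `V` determined by its values `B` on pairs of basis elements. -/
def vbr (B : ℤ ⊕ ℤ → ℤ ⊕ ℤ → VV K) : VV K →ₗ[K] VV K →ₗ[K] VV K :=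
  Finsupp.lsum K fun s => LinearMap.toSpanSingleton K (VV K →ₗ[K] VV K)
    (Finsupp.lsum K fun t => LinearMap.toSpanSingleton K (VV K) (B s t))

/-- The values on basis elements of the bracket of Statement 17 (arising from the r-matrix
`r = (x,0)⊗(x^{m+1},qxᵐ) − (x^{m+1},qxᵐ)⊗(x,0)`). -/
def B17 (m : ℤ) (q : K) : ℤ ⊕ ℤ → ℤ ⊕ ℤ → VV K
  | Sum.inl i, Sum.inl j =>
      (if j = m + 1 then (1 : K) - (i : K) else 0) • ee K i
      + (if i = 1 then 2 * (m : K) + 1 - (j : K) else 0) • ee K (j - m)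
      - (if i = m + 1 then (1 : K) - (j : K) else 0) • ee K j
      - (if j = 1 then 2 * (m : K) + 1 - (i : K) else 0) • ee K (i - m)
  | Sum.inl i, Sum.inr j =>
      (if j = m then ((1 : K) - (i : K)) * q else 0) • ee K i
      + (if i = 1 then (m : K) * q else 0) • ee K (j - m + 1)
      - (if i = 1 then (j : K) - (m : K) else 0) • ff K (j - m)
      + (if i = m + 1 then (j : K) else 0) • ff K j
  | Sum.inr j, Sum.inl i =>
      -((if j = m then ((1 : K) - (i : K)) * q else 0) • ee K i
        + (if i = 1 then (m : K) * q else 0) • ee K (j - m + 1)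
        - (if i = 1 then (j : K) - (m : K) else 0) • ff K (j - m)
        + (if i = m + 1 then (j : K) else 0) • ff K j)
  | Sum.inr i, Sum.inr j =>
      (if i = m then (j : K) * q else 0) • ff K j
      - (if j = m then (i : K) * q else 0) • ff K i

/-- The bracket `[u, v] = α(u) B v − β(u) A v − α(v) B u + β(v) A u` satisfies the Jacobi identity
as soon as `A`, `B` and their transposes act on `α`, `β` as in the two-dimensional Lie algebra
with `[A, B] = c B`. -/
theorem jacobi_of_rank_two {R M : Type*} [CommRing R] [AddCommGroup M] [Module R M]
    (br : M →ₗ[R] M →ₗ[R] M) (A B : M →ₗ[R] M) (α β : M →ₗ[R] R) (c : R)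
    (hbr : ∀ u v, br u v = α u • B v - β u • A v - α v • B u + β v • A u)
    (hAB : ∀ u, A (B u) = B (A u) + c • B u)
    (hαA : ∀ u, α (A u) = 0) (hαB : ∀ u, α (B u) = c * β u)
    (hβA : ∀ u, β (A u) = -(c * β u)) (hβB : ∀ u, β (B u) = 0) (u v w : M) :
    br (br u v) w + br (br v w) u + br (br w u) v = 0 := by
  simp only [hbr]
  simp only [map_add, map_sub, map_smul, smul_eq_mul, hAB, hαA, hαB, hβA, hβB]
  module

/-- The functional dual to `e₁`, i.e. pairing with `(x, 0)`. -/
def pairX : VV K →ₗ[K] K :=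
  Finsupp.linearCombination K (Sum.elim (fun i => if i = 1 then 1 else 0) (fun _ => 0))

/-- Pairing with `(x^{m+1}, q xᵐ)`. -/
def pairXpow (m : ℤ) (q : K) : VV K →ₗ[K] K :=
  Finsupp.linearCombination K
    (Sum.elim (fun i => if i = m + 1 then 1 else 0) (fun i => if i = m then q else 0))

/-- The coadjoint action of `(x, 0)`. -/
def coadX : VV K →ₗ[K] VV K :=
  Finsupp.linearCombination K
    (Sum.elim (fun i => (1 - (i : K)) • ee K i) (fun i => -(i : K) • ff K i))

/-- The coadjoint action of `(x^{m+1}, q xᵐ)`. -/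
def coadXpow (m : ℤ) (q : K) : VV K →ₗ[K] VV K :=
  Finsupp.linearCombination K
    (Sum.elim (fun i => (2 * (m : K) + 1 - (i : K)) • ee K (i - m))
      (fun i => ((m : K) * q) • ee K (i - m + 1) - ((i : K) - (m : K)) • ff K (i - m)))

section BasisValues

variable (m i : ℤ) (q : K)

theorem pairX_ee : pairX K (ee K i) = if i = 1 then 1 else 0 := by simp [pairX, ee]

theorem pairX_ff : pairX K (ff K i) = 0 := by simp [pairX, ff]

theorem pairXpow_ee : pairXpow K m q (ee K i) = if i = m + 1 then 1 else 0 := by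
  simp [pairXpow, ee]

theorem pairXpow_ff : pairXpow K m q (ff K i) = if i = m then q else 0 := by
  simp [pairXpow, ff]

theorem coadX_ee : coadX K (ee K i) = (1 - (i : K)) • ee K i := by simp [coadX, ee]

theorem coadX_ff : coadX K (ff K i) = -(i : K) • ff K i := by simp [coadX, ff]

theorem coadXpow_ee :
    coadXpow K m q (ee K i) = (2 * (m : K) + 1 - (i : K)) • ee K (i - m) := by
  simp [coadXpow, ee]

theorem coadXpow_ff :
    coadXpow K m q (ff K i)
      = ((m : K) * q) • ee K (i - m + 1) - ((i : K) - (m : K)) • ff K (i - m) := by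
  simp [coadXpow, ff]

end BasisValues

variable {K} in
/-- Linear maps out of `V` agree when they agree on the `eᵢ` and the `fᵢ`. -/
theorem VV_hom_ext {M : Type*} [AddCommGroup M] [Module K M] {f g : VV K →ₗ[K] M}
    (he : ∀ i, f (ee K i) = g (ee K i)) (hf : ∀ i, f (ff K i) = g (ff K i)) : f = g :=
  Finsupp.lhom_ext' fun s => LinearMap.ext_ring (s.rec he hf)

theorem vbr_single (B : ℤ ⊕ ℤ → ℤ ⊕ ℤ → VV K) (s t : ℤ ⊕ ℤ) :
    vbr K B (Finsupp.single s 1) (Finsupp.single t 1) = B s t := by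
  simp [vbr]

theorem vbr_B17_apply (m : ℤ) (q : K) (u v : VV K) :
    vbr K (B17 K m q) u v
      = pairX K u • coadXpow K m q v - pairXpow K m q u • coadX K v
        - pairX K v • coadXpow K m q u + pairXpow K m q v • coadX K u := by
  have key : vbr K (B17 K m q)
      = LinearMap.mk₂ K (fun u v => pairX K u • coadXpow K m q v - pairXpow K m q u • coadX K v
          - pairX K v • coadXpow K m q u + pairXpow K m q v • coadX K u)
          (fun _ _ _ => by simp only [map_add]; module)
          (fun _ _ _ => by simp only [map_smul, smul_eq_mul]; module)
          (fun _ _ _ => by simp only [map_add]; module)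
          (fun _ _ _ => by simp only [map_smul, smul_eq_mul]; module) := by
    refine VV_hom_ext (fun i => VV_hom_ext (fun j => ?_) fun j => ?_)
      (fun i => VV_hom_ext (fun j => ?_) fun j => ?_)
    all_goals
      simp only [LinearMap.mk₂_apply, pairX_ee, pairX_ff, pairXpow_ee, pairXpow_ff,
        coadX_ee, coadX_ff, coadXpow_ee, coadXpow_ff]
      simp only [ee, ff, vbr_single]
      simp only [B17, ee, ff]
      split_ifs <;> module
  rw [key, LinearMap.mk₂_apply]

theorem coadX_coadXpow (m : ℤ) (q : K) (u : VV K) :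
    coadX K (coadXpow K m q u) = coadXpow K m q (coadX K u) + (m : K) • coadXpow K m q u := by
  have key : coadX K ∘ₗ coadXpow K m q = coadXpow K m q ∘ₗ coadX K + (m : K) • coadXpow K m q := by
    refine VV_hom_ext (fun i => ?_) fun i => ?_
    all_goals
      simp only [LinearMap.comp_apply, LinearMap.add_apply, LinearMap.smul_apply, map_smul,
        map_sub, coadX_ee, coadX_ff, coadXpow_ee, coadXpow_ff]
      push_cast
      module
  exact LinearMap.congr_fun key u

theorem pairX_coadX (u : VV K) : pairX K (coadX K u) = 0 := by
  have key : pairX K ∘ₗ coadX K = 0 := by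
    refine VV_hom_ext (fun i => ?_) fun i => ?_
    · by_cases h : i = 1 <;> simp [coadX_ee, pairX_ee, h]
    · simp [coadX_ff, pairX_ff]
  exact LinearMap.congr_fun key u

theorem pairX_coadXpow (m : ℤ) (q : K) (u : VV K) :
    pairX K (coadXpow K m q u) = m * pairXpow K m q u := by
  have key : pairX K ∘ₗ coadXpow K m q = (m : K) • pairXpow K m q := by
    refine VV_hom_ext (fun i => ?_) fun i => ?_
    · have hi : i - m = 1 ↔ i = m + 1 := by omega
      by_cases h : i = m + 1
      · simp [coadXpow_ee, pairX_ee, pairXpow_ee, h]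
        ring
      · simp [coadXpow_ee, pairX_ee, pairXpow_ee, hi, h]
    · by_cases h : i = m <;>
        simp [coadXpow_ff, pairX_ee, pairX_ff, pairXpow_ff, h, sub_eq_zero]
  exact LinearMap.congr_fun key u

theorem pairXpow_coadX (m : ℤ) (q : K) (u : VV K) :
    pairXpow K m q (coadX K u) = -(m * pairXpow K m q u) := by
  have key : pairXpow K m q ∘ₗ coadX K = -((m : K) • pairXpow K m q) := by
    refine VV_hom_ext (fun i => ?_) fun i => ?_
    · by_cases h : i = m + 1 <;> simp [coadX_ee, pairXpow_ee, h]
    · by_cases h : i = m <;> simp [coadX_ff, pairXpow_ff, h]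
  exact LinearMap.congr_fun key u

theorem pairXpow_coadXpow (m : ℤ) (q : K) (u : VV K) :
    pairXpow K m q (coadXpow K m q u) = 0 := by
  have key : pairXpow K m q ∘ₗ coadXpow K m q = 0 := by
    refine VV_hom_ext (fun i => ?_) fun i => ?_
    · have hi : i - m = m + 1 ↔ i = 2 * m + 1 := by omega
      by_cases h : i = 2 * m + 1
      · simp [coadXpow_ee, h]
      · simp [coadXpow_ee, pairXpow_ee, hi, h]
    · have hi : i - m = m ↔ i = 2 * m := by omega
      by_cases h : i = 2 * m
      · have hm : 2 * m - m = m := by ring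
        simp [coadXpow_ff, pairXpow_ee, pairXpow_ff, h, hm]
        ring
      · simp [coadXpow_ff, pairXpow_ee, pairXpow_ff, hi, h]
  exact LinearMap.congr_fun key u

/-- the bilinear bracket on the space `V` with basis `{eᵢ} ∪ {fᵢ}` given by
`[eᵢ,eⱼ] = δ_{j,m+1}(1−i)eᵢ + δ_{i,1}(2m+1−j)e_{j−m} − δ_{i,m+1}(1−j)eⱼ − δ_{j,1}(2m+1−i)e_{i−m}`,
`[eᵢ,fⱼ] = δ_{j,m}(1−i)q·eᵢ + δ_{i,1}(mq·e_{j−m+1} − (j−m)f_{j−m}) + δ_{i,m+1}·j·fⱼ`,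
`[fⱼ,eᵢ] = −[eᵢ,fⱼ]`, `[fᵢ,fⱼ] = δ_{i,m}·jq·fⱼ − δ_{j,m}·iq·fᵢ` is alternating and satisfies
the Jacobi identity, so it makes `V` an infinite-dimensional Lie algebra. -/
theorem statement17 [CharZero K] (m : ℤ) (q : K) :
    (∀ u : VV K, vbr K (B17 K m q) u u = 0) ∧
    (∀ u v w : VV K,
      vbr K (B17 K m q) (vbr K (B17 K m q) u v) w
        + vbr K (B17 K m q) (vbr K (B17 K m q) v w) u
        + vbr K (B17 K m q) (vbr K (B17 K m q) w u) v = 0) ∧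
    ¬ FiniteDimensional K (VV K) := by
  refine ⟨fun u => ?_, jacobi_of_rank_two _ (coadX K) (coadXpow K m q) (pairX K) (pairXpow K m q) m
    (vbr_B17_apply K m q) (coadX_coadXpow K m q) (pairX_coadX K) (pairX_coadXpow K m q)
    (pairXpow_coadX K m q) (pairXpow_coadXpow K m q), fun h => ?_⟩
  · rw [vbr_B17_apply]
    module
  · exact not_finite_iff_infinite.mpr inferInstance
      (Module.Finite.finite_basis (Finsupp.basisSingleOne (R := K) (ι := ℤ ⊕ ℤ)))

end
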